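/- arXiv:1908.09916 — 6 statements merged into one kernel-verified Lean document; each statement's English description precedes it below -/
import Mathlib

section
/- Let L be a finitely generated free abelian group and ⟨·,·⟩ : L × L → ℤ a unimodular symmetric bilinear form, and let c ∈ L be a characteristic element. Then for every x ∈ L one has ⟨c+2x, c+2x⟩ ≡ ⟨c,c⟩ (mod 8); that is, ⟨c,c⟩ mod 8 is independent of the choice of characteristic element c. -/
/-- For a unimodular symmetric bilinear form on a finitely generated free
abelian group with characteristic element `c`, one has
`⟨c + 2x, c + 2x⟩ ≡ ⟨c,c⟩ (mod 8)` for every `x`; i.e. `⟨c,c⟩ mod 8` is independent of the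
choice of characteristic element. -/
theorem characteristic_self_pairing_mod_eight
    (L : Type*) [AddCommGroup L] [Module.Free ℤ L] [Module.Finite ℤ L]
    (B : L →ₗ[ℤ] L →ₗ[ℤ] ℤ)
    (hsymm : ∀ x y : L, B x y = B y x)
    (hunimod : Function.Bijective fun y : L => B.flip y)
    (c : L)
    (hc : ∀ x : L, B x x ≡ B c x [ZMOD 2])
    (x : L) :
    B (c + (2 : ℤ) • x) (c + (2 : ℤ) • x) ≡ B c c [ZMOD 8] := by
  obtain ⟨k, hk⟩ := (hc x).add_right (B c x) |>.symm.dvd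
  have hexp : B (c + (2 : ℤ) • x) (c + (2 : ℤ) • x) = B c c + 4 * (B x x + B c x) := by
    simp only [map_add, map_smul, LinearMap.add_apply, LinearMap.smul_apply, smul_eq_mul,
      hsymm x c]
    ring
  rw [hexp]
  refine (Int.modEq_iff_dvd.mpr ⟨k + B c x, ?_⟩).symm
  linarith
end

section
/- Let L be a finitely generated free abelian group, T : L × L × L → ℤ a symmetric trilinear form, and c ∈ L a characteristic element for T. Then the map f_c : L → ℤ/24ℤ defined by f_c(x) = 4T(x,x,x) + 6T(c,x,x) + 3T(c,c,x) (mod 24) is additive: for all x, y ∈ L, f_c(x+y) = f_c(x) + f_c(y) in ℤ/24ℤ. -/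
/-- Let `T` be a symmetric trilinear form on a finitely generated free
abelian group `L` and `c ∈ L` a characteristic element for `T`.  Then the map
`f_c : L → ℤ/24ℤ`, `f_c(x) = 4T(x,x,x) + 6T(c,x,x) + 3T(c,c,x) (mod 24)`, is additive. -/
theorem cubic_form_additive_mod_24
    (L : Type*) [AddCommGroup L] [Module.Free ℤ L] [Module.Finite ℤ L]
    (T : L →ₗ[ℤ] L →ₗ[ℤ] L →ₗ[ℤ] ℤ)
    (hsymm12 : ∀ x y z : L, T x y z = T y x z)
    (hsymm23 : ∀ x y z : L, T x y z = T x z y)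
    (c : L)
    (hc : ∀ x y : L, T c x y ≡ T x x y + T x y y [ZMOD 2]) :
    ∀ x y : L,
      ((4 * T (x + y) (x + y) (x + y) + 6 * T c (x + y) (x + y)
          + 3 * T c c (x + y) : ℤ) : ZMod 24)
        = ((4 * T x x x + 6 * T c x x + 3 * T c c x : ℤ) : ZMod 24)
          + ((4 * T y y y + 6 * T c y y + 3 * T c c y : ℤ) : ZMod 24) := by
  intro x y
  obtain ⟨k, hk⟩ := (hc x y).dvd
  rw [← Int.cast_add, ZMod.intCast_eq_intCast_iff]
  refine Int.ModEq.symm (Int.modEq_iff_dvd.mpr ⟨T c x y + k, ?_⟩)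
  simp only [map_add, LinearMap.add_apply]
  have hxyx : T x y x = T x x y := hsymm23 x y x
  have hyxx : T y x x = T x x y := (hsymm12 y x x).trans hxyx
  have hyxy : T y x y = T x y y := hsymm12 y x y
  have hyyx : T y y x = T x y y := (hsymm23 y y x).trans hyxy
  have hcyx : T c y x = T c x y := hsymm23 c y x
  rw [hxyx, hyxx, hyxy, hyyx, hcyx]
  push_cast at hk ⊢
  linarith
end

section
/- Let L be a finitely generated free abelian group, T : L × L × L → ℤ a symmetric trilinear form, and c ∈ L a characteristic element for T. Then for every y ∈ L and every x ∈ L one has 4T(x,x,x) + 6T(c+2y, x, x) + 3T(c+2y, c+2y, x) ≡ 4T(x,x,x) + 6T(c,x,x) + 3T(c,c,x) (mod 24); that is, the expression 4x³ + 6cx² + 3c²x mod 24 is unchanged when the characteristic element c is replaced by c + 2y. -/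
/-- Let `T` be a symmetric trilinear form on a finitely generated free
abelian group `L` and `c ∈ L` a characteristic element for `T`.  The expression
`4x³ + 6cx² + 3c²x (mod 24)` is unchanged when `c` is replaced by `c + 2y`. -/
theorem cubic_form_indep_of_characteristic_mod_24
    (L : Type*) [AddCommGroup L] [Module.Free ℤ L] [Module.Finite ℤ L]
    (T : L →ₗ[ℤ] L →ₗ[ℤ] L →ₗ[ℤ] ℤ)
    (hsymm12 : ∀ x y z : L, T x y z = T y x z)
    (hsymm23 : ∀ x y z : L, T x y z = T x z y)
    (c : L)
    (hc : ∀ x y : L, T c x y ≡ T x x y + T x y y [ZMOD 2]) :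
    ∀ y x : L,
      4 * T x x x + 6 * T (c + (2 : ℤ) • y) x x
          + 3 * T (c + (2 : ℤ) • y) (c + (2 : ℤ) • y) x
        ≡ 4 * T x x x + 6 * T c x x + 3 * T c c x [ZMOD 24] := by
  intro y x
  have hyxx : T y x x = T x x y := by rw [hsymm12 y x x, hsymm23 x y x]
  have hyyx : T y y x = T x y y := by rw [hsymm23 y y x, hsymm12 y x y]
  have hycx : T y c x = T c x y := by rw [hsymm12 y c x, hsymm23 c y x]
  obtain ⟨k, hk⟩ := (hc x y).dvd
  refine (Int.modEq_iff_dvd.2 ⟨-(k + T c x y), ?_⟩)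
  simp only [map_add, map_smul, LinearMap.add_apply, LinearMap.smul_apply, smul_eq_mul,
    hyxx, hyyx, hycx, hsymm23 c y x]
  linarith
end

section
/- Let L be a finitely generated free abelian group, T : L × L × L → ℤ a symmetric trilinear form, and c ∈ L a characteristic element for T. Then there exists a unique group homomorphism p̂ : L → ℤ/24ℤ such that p̂(x) equals the class of 4T(x,x,x) + 6T(c,x,x) + 3T(c,c,x) modulo 24 for all x ∈ L; moreover p̂ is unchanged if c is replaced by any other characteristic element of the form c + 2y with y ∈ L. -/
/-- Lemma 4.2 / thm:10 of the paper.  Let `T` be a symmetric trilinear form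
on a finitely generated free abelian group `L` and `c ∈ L` a characteristic element for `T`.
Then there is a unique group homomorphism `p̂ : L → ℤ/24ℤ` with
`p̂(x) = 4T(x,x,x) + 6T(c,x,x) + 3T(c,c,x) (mod 24)` for all `x`; moreover `p̂` is unchanged
when `c` is replaced by any characteristic element of the form `c + 2y`. -/
theorem exists_unique_phat_mod_24
    (L : Type*) [AddCommGroup L] [Module.Free ℤ L] [Module.Finite ℤ L]
    (T : L →ₗ[ℤ] L →ₗ[ℤ] L →ₗ[ℤ] ℤ)
    (hsymm12 : ∀ x y z : L, T x y z = T y x z)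
    (hsymm23 : ∀ x y z : L, T x y z = T x z y)
    (c : L)
    (hc : ∀ x y : L, T c x y ≡ T x x y + T x y y [ZMOD 2]) :
    (∃! p : L →+ ZMod 24,
        ∀ x : L, p x = ((4 * T x x x + 6 * T c x x + 3 * T c c x : ℤ) : ZMod 24)) ∧
    (∀ p : L →+ ZMod 24,
        (∀ x : L, p x = ((4 * T x x x + 6 * T c x x + 3 * T c c x : ℤ) : ZMod 24)) →
        ∀ y x : L,
          p x = ((4 * T x x x + 6 * T (c + (2 : ℤ) • y) x x
              + 3 * T (c + (2 : ℤ) • y) (c + (2 : ℤ) • y) x : ℤ) : ZMod 24)) := by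
  refine ⟨?_, ?_⟩
  · refine ⟨AddMonoidHom.mk'
      (fun x : L => ((4 * T x x x + 6 * T c x x + 3 * T c c x : ℤ) : ZMod 24)) ?_,
      fun _ => rfl, fun q hq => AddMonoidHom.ext hq⟩
    intro x y
    rw [← Int.cast_add, eq_comm]
    refine (ZMod.intCast_eq_intCast_iff_dvd_sub _ _ 24).mpr ?_
    obtain ⟨k, hk⟩ := (hc x y).dvd
    simp only [map_add, LinearMap.add_apply]
    rw [hsymm12 y x x, hsymm23 x y x, hsymm12 y x y, hsymm23 y y x, hsymm12 y x y,
      hsymm23 c y x]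
    refine ⟨k + T c x y, ?_⟩
    push_cast
    linarith
  · intro p hp y x
    rw [hp x]
    refine (ZMod.intCast_eq_intCast_iff_dvd_sub _ _ 24).mpr ?_
    obtain ⟨k, hk⟩ := (hc y x).dvd
    simp only [map_add, map_smul, LinearMap.add_apply, LinearMap.smul_apply, smul_eq_mul]
    rw [hsymm12 y c x]
    refine ⟨k + T c y x, ?_⟩
    push_cast
    linarith
end

section
/- Let L be a finitely generated free abelian group, T : L × L × L → ℤ a symmetric trilinear form, and c ∈ L a characteristic element for T. Suppose p : L → ℤ is a group homomorphism such that p(x) ≡ 4T(x,x,x) + 6T(c,x,x) + 3T(c,c,x) (mod 24) for all x ∈ L. Then for every y ∈ L, writing c′ = c + 2y, one has T(c′,c′,c′) − p(c′) ≡ T(c,c,c) − p(c) (mod 48); equivalently, the mod-2 class of (c³ − p·c)/24 is independent of the characteristic element c in its mod-2 class. -/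
/-- Let `T` be a symmetric trilinear form on a finitely generated free
abelian group `L`, `c ∈ L` characteristic for `T`, and `p : L → ℤ` a group homomorphism with
`p(x) ≡ 4T(x,x,x) + 6T(c,x,x) + 3T(c,c,x) (mod 24)` for all `x`.  Then for every `y ∈ L`,
writing `c' = c + 2y`, one has `T(c',c',c') − p(c') ≡ T(c,c,c) − p(c) (mod 48)`;
equivalently, the mod-2 class of `(c³ − p·c)/24` depends only on the mod-2 class of `c`. -/
theorem cube_sub_p_indep_mod_48
    (L : Type*) [AddCommGroup L] [Module.Free ℤ L] [Module.Finite ℤ L]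
    (T : L →ₗ[ℤ] L →ₗ[ℤ] L →ₗ[ℤ] ℤ)
    (hsymm12 : ∀ x y z : L, T x y z = T y x z)
    (hsymm23 : ∀ x y z : L, T x y z = T x z y)
    (c : L)
    (hc : ∀ x y : L, T c x y ≡ T x x y + T x y y [ZMOD 2])
    (p : L →+ ℤ)
    (hp : ∀ x : L, p x ≡ 4 * T x x x + 6 * T c x x + 3 * T c c x [ZMOD 24]) :
    ∀ y : L,
      T (c + (2 : ℤ) • y) (c + (2 : ℤ) • y) (c + (2 : ℤ) • y) - p (c + (2 : ℤ) • y)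
        ≡ T c c c - p c [ZMOD 48] := by
  intro y
  have hcube : T (c + (2 : ℤ) • y) (c + (2 : ℤ) • y) (c + (2 : ℤ) • y)
      = T c c c + 6 * T c c y + 12 * T c y y + 8 * T y y y := by
    simp only [map_add, map_smul, LinearMap.add_apply, LinearMap.smul_apply, smul_eq_mul]
    rw [hsymm12 y c c, hsymm12 y c y, hsymm23 y y c, hsymm12 y c y, hsymm23 c y c]
    ring
  have hlin : p (c + (2 : ℤ) • y) = p c + 2 * p y := by
    rw [map_add, map_zsmul, smul_eq_mul]
  obtain ⟨k, hk⟩ := (hp y).dvd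
  rw [hcube, hlin]
  refine (Int.modEq_iff_dvd.mpr ⟨-k, ?_⟩)
  linarith
end

section
/- Let L be a finitely generated free abelian group, T : L × L × L → ℤ a symmetric trilinear form, and c ∈ L a characteristic element for T. Then there exists a group homomorphism p : L → ℤ such that p(x) ≡ 4T(x,x,x) + 6T(c,x,x) + 3T(c,c,x) (mod 24) for all x ∈ L and such that 48 divides T(c,c,c) − p(c); consequently κ₃(c) := (T(c,c,c) − p(c))/48 is an integer. -/
theorem AddMonoidHom.exists_lift_zmod {L : Type*} [AddCommGroup L] [Module.Free ℤ L] {n : ℕ}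
    (g : L →+ ZMod n) : ∃ p : L →ₗ[ℤ] ℤ, ∀ x, (p x : ZMod n) = g x := by
  obtain ⟨p, hp⟩ := Module.projective_lifting_property
    (Int.castAddHom (ZMod n)).toIntLinearMap g.toIntLinearMap ZMod.intCast_surjective
  exact ⟨p, fun x => LinearMap.congr_fun hp x⟩

/-- A function on a free abelian group that is additive modulo `n` is congruent modulo `n` to an
integral linear form. -/
theorem exists_linearMap_modEq_of_additive {L : Type*} [AddCommGroup L] [Module.Free ℤ L] {n : ℕ}
    (f : L → ℤ) (hf : ∀ x y, f (x + y) ≡ f x + f y [ZMOD n]) :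
    ∃ p : L →ₗ[ℤ] ℤ, ∀ x, p x ≡ f x [ZMOD n] := by
  obtain ⟨p, hp⟩ := AddMonoidHom.exists_lift_zmod
    (AddMonoidHom.mk' (fun x => (f x : ZMod n)) fun x y => by
      rw [← Int.cast_add]
      exact (ZMod.intCast_eq_intCast_iff _ _ _).2 (hf x y))
  exact ⟨p, fun x => (ZMod.intCast_eq_intCast_iff _ _ _).1 (hp x)⟩

theorem exists_eq_smul_or_exists_not_dvd {L : Type*} [AddCommGroup L] [Module.Free ℤ L]
    (n : ℤ) (c : L) : (∃ d, c = n • d) ∨ ∃ q : L →ₗ[ℤ] ℤ, ¬ n ∣ q c := by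
  rw [or_iff_not_imp_right]
  intro h
  push Not at h
  let b := Module.Free.chooseBasis ℤ L
  choose k hk using fun i => h (b.coord i)
  refine ⟨(b.repr c).sum fun i _ => k i • b i, ?_⟩
  conv_lhs => rw [← b.linearCombination_repr c, Finsupp.linearCombination_apply]
  rw [Finsupp.smul_sum]
  refine Finsupp.sum_congr fun i _ => ?_
  rw [smul_smul, ← hk i, Module.Basis.coord_apply]


/-- existence part of Lemma 4.3 / thm:11 of the paper.  Let `T` be a
symmetric trilinear form on a finitely generated free abelian group `L` and `c ∈ L`
characteristic for `T`.  Then there exists a group homomorphism `p : L → ℤ` with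
`p(x) ≡ 4T(x,x,x) + 6T(c,x,x) + 3T(c,c,x) (mod 24)` for all `x` and with
`48 ∣ T(c,c,c) − p(c)`; consequently `κ₃(c) = (T(c,c,c) − p(c))/48` is an integer. -/
theorem exists_p_with_kappa_integral
    (L : Type*) [AddCommGroup L] [Module.Free ℤ L] [Module.Finite ℤ L]
    (T : L →ₗ[ℤ] L →ₗ[ℤ] L →ₗ[ℤ] ℤ)
    (hsymm12 : ∀ x y z : L, T x y z = T y x z)
    (hsymm23 : ∀ x y z : L, T x y z = T x z y)
    (c : L)
    (hc : ∀ x y : L, T c x y ≡ T x x y + T x y y [ZMOD 2]) :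
    ∃ p : L →+ ℤ,
      (∀ x : L, p x ≡ 4 * T x x x + 6 * T c x x + 3 * T c c x [ZMOD 24]) ∧
      (48 : ℤ) ∣ T c c c - p c := by
  have hadd (x y : L) : 4 * T (x + y) (x + y) (x + y) + 6 * T c (x + y) (x + y) + 3 * T c c (x + y)
      ≡ (4 * T x x x + 6 * T c x x + 3 * T c c x) + (4 * T y y y + 6 * T c y y + 3 * T c c y)
        [ZMOD (24 : ℕ)] := by
    have h := (hc x y).dvd
    have h₁ := hsymm23 x y x
    have h₂ := hsymm12 y x x
    have h₃ := hsymm12 y x y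
    have h₄ := hsymm23 y y x
    have h₅ := hsymm23 c y x
    simp only [map_add, LinearMap.add_apply, Int.ModEq]
    push_cast
    omega
  obtain ⟨p, hp⟩ := exists_linearMap_modEq_of_additive
    (fun x => 4 * T x x x + 6 * T c x x + 3 * T c c x) hadd
  have hccc := (hc c c).dvd
  have hpc := (hp c).dvd
  push_cast at hp hpc
  obtain ⟨d, rfl⟩ | ⟨q, hq⟩ := exists_eq_smul_or_exists_not_dvd 2 c
  · refine ⟨p.toAddMonoidHom, hp, ?_⟩
    have hpd := (hp d).dvd
    simp only [map_smul, LinearMap.smul_apply, smul_eq_mul, LinearMap.toAddMonoidHom_coe] at hpd ⊢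
    omega
  · by_cases h : (48 : ℤ) ∣ T c c c - p c
    · exact ⟨p.toAddMonoidHom, hp, h⟩
    · refine ⟨(p + (24 : ℤ) • q).toAddMonoidHom, fun x => ?_, ?_⟩
      · have hpx := (hp x).dvd
        simp only [LinearMap.toAddMonoidHom_coe, LinearMap.add_apply, LinearMap.smul_apply,
          smul_eq_mul, Int.ModEq]
        omega
      · simp only [LinearMap.toAddMonoidHom_coe, LinearMap.add_apply, LinearMap.smul_apply,
          smul_eq_mul]
        omega
end
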